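/- Let f : ℝ → ℝ be measurable with ∫_ℝ f(x)² e^{−x²/2} dx < ∞ and ∫_ℝ f(x) e^{−x²/2} dx = 0, with Hermite expansion f = Σ_{l≥q} a_l H_l where a_q ≠ 0 (q is the Hermite rank). If X, Y are jointly standard Gaussian with correlation ρ = E[XY], then |E[f(X) f(Y)]| ≤ |ρ|^q · Σ_{l≥q} l! a_l². -/

import Mathlib

open MeasureTheory ProbabilityTheory

/-- The `n`-th probabilists' Hermite polynomial, as a function `ℝ → ℝ`. -/
noncomputable def He (n : ℕ) (x : ℝ) : ℝ := Polynomial.aeval x (Polynomial.hermite n)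

/-- Hermite polynomial with real coefficients. -/
noncomputable def hR (n : ℕ) : Polynomial ℝ := (Polynomial.hermite n).map (Int.castRingHom ℝ)

lemma He_eq (n : ℕ) (x : ℝ) : He n x = (hR n).eval x := by
  simp [He, hR, Polynomial.aeval_def, Polynomial.eval_map]

lemma hR_zero : hR 0 = 1 := by simp [hR]

lemma hR_succ (n : ℕ) : hR (n+1) = Polynomial.X * hR n - Polynomial.derivative (hR n) := by
  simp [hR, Polynomial.derivative_map]

lemma hR_deriv (n : ℕ) : Polynomial.derivative (hR (n+1)) = Polynomial.C ((n:ℝ)+1) * hR n := by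
  induction n with
  | zero => simp [hR_succ, hR_zero]
  | succ n ih =>
    rw [hR_succ (n+1), Polynomial.derivative_sub, ih, Polynomial.derivative_mul,
      ih, Polynomial.derivative_mul, hR_succ n]
    simp
    ring

lemma integrable_poly (p : Polynomial ℝ) :
    Integrable (fun x => p.eval x) (gaussianReal 0 1) := by
  induction p using Polynomial.induction_on' with
  | add p q hp hq =>
    simp only [Polynomial.eval_add]
    exact hp.add hq
  | monomial n a =>
    simp only [Polynomial.eval_monomial]
    apply Integrable.const_mul
    have h := (memLp_id_gaussianReal (μ := 0) (v := 1) (n : NNReal)).integrable_norm_pow'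
    refine (integrable_norm_iff (by fun_prop)).1 ?_
    simpa using h

lemma integrable_poly_pdf (p : Polynomial ℝ) :
    Integrable (fun x => gaussianPDFReal 0 1 x * p.eval x) := by
  have h := integrable_poly p
  rw [gaussianReal_of_var_ne_zero _ one_ne_zero,
    integrable_withDensity_iff (by fun_prop) (by simp [gaussianPDF_lt_top])] at h
  simpa [toReal_gaussianPDF, mul_comm] using h

lemma stein (p : Polynomial ℝ) :
    ∫ x, x * p.eval x ∂(gaussianReal 0 1)
      = ∫ x, (Polynomial.derivative p).eval x ∂(gaussianReal 0 1) := by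
  have hd : ∀ x, HasDerivAt (fun x => gaussianPDFReal 0 1 x * p.eval x)
      (gaussianPDFReal 0 1 x * (Polynomial.derivative p - Polynomial.X * p).eval x) x := by
    intro x
    have h1 : HasDerivAt (gaussianPDFReal 0 1) (- x * gaussianPDFReal 0 1 x) x := by
      unfold gaussianPDFReal
      have : HasDerivAt (fun x : ℝ => -(x - 0)^2 / (2 * ((1:NNReal):ℝ))) (-x) x := by
        have := (((hasDerivAt_id x).sub_const 0).pow 2).neg.div_const (2 * ((1:NNReal):ℝ))
        convert! this using 1
        simp
        ring
      convert! (this.exp.const_mul _) using 1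
      ring
    convert! h1.mul (p.hasDerivAt x) using 1
    simp
    ring
  have := integral_eq_zero_of_hasDerivAt_of_integrable hd (integrable_poly_pdf _)
    (integrable_poly_pdf _)
  have h2 : ∫ x, (Polynomial.derivative p - Polynomial.X * p).eval x ∂(gaussianReal 0 1) = 0 := by
    rw [integral_gaussianReal_eq_integral_smul one_ne_zero]
    simpa using this
  simp only [Polynomial.eval_sub] at h2
  rw [integral_sub (integrable_poly _) (integrable_poly _)] at h2
  simp only [Polynomial.eval_mul, Polynomial.eval_X] at h2
  linarith

lemma herm_step (l : ℕ) (p : Polynomial ℝ) :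
    ∫ x, (hR (l+1) * p).eval x ∂(gaussianReal 0 1)
      = ∫ x, (hR l * Polynomial.derivative p).eval x ∂(gaussianReal 0 1) := by
  have h1 := stein (hR l * p)
  have e : hR (l+1) * p = Polynomial.X * (hR l * p) - Polynomial.derivative (hR l) * p := by
    rw [hR_succ]; ring
  have e2 : Polynomial.derivative (hR l * p)
    = Polynomial.derivative (hR l) * p + hR l * Polynomial.derivative p :=
    Polynomial.derivative_mul
  rw [e2] at h1
  rw [e]
  simp only [Polynomial.eval_sub, Polynomial.eval_add] at h1 ⊢
  rw [integral_add (integrable_poly _) (integrable_poly _)] at h1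
  rw [integral_sub (integrable_poly _) (integrable_poly _)]
  simp only [Polynomial.eval_mul, Polynomial.eval_X] at h1 ⊢
  linarith

lemma herm_orth (l m : ℕ) :
    ∫ x, (hR l * hR m).eval x ∂(gaussianReal 0 1)
      = if l = m then (l.factorial : ℝ) else 0 := by
  induction l generalizing m with
  | zero =>
    cases m with
    | zero => simp [hR_zero]
    | succ m =>
      rw [mul_comm, herm_step]; simp [hR_zero]
  | succ l ih =>
    rw [herm_step]
    cases m with
    | zero => simp [hR_zero]
    | succ m =>
      rw [hR_deriv]
      have : ∀ x, (hR l * (Polynomial.C ((m:ℝ)+1) * hR m)).eval x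
        = ((m:ℝ)+1) * (hR l * hR m).eval x := by intro x; simp; ring
      simp_rw [this, integral_const_mul, ih]
      by_cases h : l = m
      · subst h; simp [Nat.factorial_succ]
      · simp [h]

lemma mehler (ρ σ : ℝ) (h : ρ^2 + σ^2 = 1) (m : ℕ) (x : ℝ) :
    ∫ z, (hR m).eval (ρ * x + σ * z) ∂(gaussianReal 0 1) = ρ ^ m * (hR m).eval x := by
  have hint : ∀ p : Polynomial ℝ, Integrable (fun z => p.eval (ρ * x + σ * z)) (gaussianReal 0 1) := by
    intro p
    convert! integrable_poly (p.comp (Polynomial.C (ρ*x) + Polynomial.C σ * Polynomial.X)) using 2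
    simp [-map_mul]
  have hst : ∀ p : Polynomial ℝ, ∫ z, z * p.eval (ρ * x + σ * z) ∂(gaussianReal 0 1)
      = σ * ∫ z, (Polynomial.derivative p).eval (ρ * x + σ * z) ∂(gaussianReal 0 1) := by
    intro p
    have := stein (p.comp (Polynomial.C (ρ*x) + Polynomial.C σ * Polynomial.X))
    simpa [-map_mul, Polynomial.derivative_comp, integral_const_mul] using this
  have hintz : ∀ p : Polynomial ℝ, Integrable (fun z => z * p.eval (ρ * x + σ * z)) (gaussianReal 0 1) := by
    intro p
    convert! integrable_poly (Polynomial.X * p.comp (Polynomial.C (ρ*x) + Polynomial.C σ * Polynomial.X)) using 2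
    simp [-map_mul]
  have key : ∀ m, ∫ z, (hR (m+1)).eval (ρ * x + σ * z) ∂(gaussianReal 0 1)
     = ρ * x * ∫ z, (hR m).eval (ρ * x + σ * z) ∂(gaussianReal 0 1)
      - ρ^2 * ∫ z, (Polynomial.derivative (hR m)).eval (ρ * x + σ * z) ∂(gaussianReal 0 1) := by
    intro m
    have e : ∀ z, (hR (m+1)).eval (ρ * x + σ * z) = (ρ * x) * (hR m).eval (ρ * x + σ * z)
      + σ * (z * (hR m).eval (ρ * x + σ * z)) - (Polynomial.derivative (hR m)).eval (ρ * x + σ * z) := by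
      intro z; rw [hR_succ]; simp; ring
    simp_rw [e]
    rw [integral_sub (by exact ((hint _).const_mul _).add ((hintz _).const_mul _)) (hint _),
      integral_add ((hint _).const_mul _) ((hintz _).const_mul _), integral_const_mul,
      integral_const_mul, hst]
    linear_combination (∫ z, (Polynomial.derivative (hR m)).eval (ρ * x + σ * z) ∂(gaussianReal 0 1)) * h
  induction m using Nat.strong_induction_on with
  | _ m ih =>
    cases m with
    | zero => simp [hR_zero]
    | succ m =>
      rw [key, ih m (by omega)]
      cases m with
      | zero => simp [hR_zero, hR_succ]
      | succ m =>
        have e : ∀ y, (Polynomial.derivative (hR (m+1))).eval y = ((m:ℝ)+1) * (hR m).eval y := by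
          intro y; rw [hR_deriv]; simp
        simp_rw [e, integral_const_mul]
        rw [ih m (by omega), hR_succ (m+1)]
        simp only [Polynomial.eval_sub, Polynomial.eval_mul, Polynomial.eval_X, e]
        ring

lemma memLp_poly (p : Polynomial ℝ) : MemLp (fun x => p.eval x) 2 (gaussianReal 0 1) := by
  rw [memLp_two_iff_integrable_sq (by fun_prop)]
  convert! integrable_poly (p^2) using 2
  simp

lemma memLp_exp_abs (t : ℝ) : MemLp (fun x => Real.exp (t * |x|)) 2 (gaussianReal 0 1) := by
  rw [memLp_two_iff_integrable_sq (by fun_prop)]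
  have := integrable_exp_mul_abs (X := fun x : ℝ => x) (μ := gaussianReal 0 1) (t := 2*t)
    (integrable_exp_mul_gaussianReal _) (integrable_exp_mul_gaussianReal _)
  convert! this using 2
  rw [sq, ← Real.exp_add]
  ring_nf

lemma integrable_mul_poly {g : ℝ → ℝ} (hg : MemLp g 2 (gaussianReal 0 1)) (p : Polynomial ℝ) :
    Integrable (fun x => g x * p.eval x) (gaussianReal 0 1) :=
  hg.integrable_mul (memLp_poly p)

lemma moments_zero {g : ℝ → ℝ} (hg : MemLp g 2 (gaussianReal 0 1))
    (h : ∀ n, ∫ x, g x * (hR n).eval x ∂(gaussianReal 0 1) = 0) (k : ℕ) :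
    ∫ x, g x * x ^ k ∂(gaussianReal 0 1) = 0 := by
  have main : ∀ k n, ∫ x, g x * (Polynomial.X ^ k * hR n).eval x ∂(gaussianReal 0 1) = 0 := by
    intro k
    induction k with
    | zero => simpa using h
    | succ k ih =>
      intro n
      have hd : ∫ x, g x * (Polynomial.X ^ k * Polynomial.derivative (hR n)).eval x
          ∂(gaussianReal 0 1) = 0 := by
        cases n with
        | zero => simp [hR_zero]
        | succ n =>
          rw [hR_deriv]
          have e : ∀ x, g x * (Polynomial.X ^ k * (Polynomial.C ((n:ℝ)+1) * hR n)).eval x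
            = ((n:ℝ)+1) * (g x * (Polynomial.X ^ k * hR n).eval x) := by
            intro x; simp; ring
          simp_rw [e, integral_const_mul, ih, mul_zero]
      have e : ∀ x, g x * (Polynomial.X ^ (k+1) * hR n).eval x
          = g x * (Polynomial.X ^ k * hR (n+1)).eval x
          + g x * (Polynomial.X ^ k * Polynomial.derivative (hR n)).eval x := by
        intro x; rw [hR_succ]; simp; ring
      simp_rw [e]
      rw [integral_add (integrable_mul_poly hg _) (integrable_mul_poly hg _), ih, hd, add_zero]
  simpa [hR_zero] using main k 0

lemma hermFourier_zero {g : ℝ → ℝ} (hg : MemLp g 2 (gaussianReal 0 1))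
    (h : ∀ k : ℕ, ∫ x, g x * x ^ k ∂(gaussianReal 0 1) = 0) (t : ℝ) :
    ∫ x, (g x : ℂ) * Complex.exp (t * x * Complex.I) ∂(gaussianReal 0 1) = 0 := by
  have hs := hasSum_integral_of_dominated_convergence (μ := gaussianReal 0 1)
    (F := fun (n : ℕ) (x : ℝ) => (g x : ℂ) * ((t * x * Complex.I) ^ n / (n.factorial : ℂ)))
    (f := fun x => (g x : ℂ) * Complex.exp (t * x * Complex.I))
    (fun n x => |g x| * ((|t| * |x|) ^ n / (n.factorial : ℝ))) ?_ ?_ ?_ ?_ ?_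
  · have h0 : ∀ n : ℕ, ∫ x, (g x : ℂ) * ((t * x * Complex.I) ^ n / (n.factorial : ℂ))
        ∂(gaussianReal 0 1) = 0 := by
      intro n
      have e : ∀ x : ℝ, (g x : ℂ) * ((t * x * Complex.I) ^ n / (n.factorial : ℂ))
        = ((t * Complex.I) ^ n / (n.factorial : ℂ)) * ((g x * x ^ n : ℝ) : ℂ) := by
        intro x; push_cast; ring
      simp_rw [e]
      rw [integral_const_mul, integral_complex_ofReal, h]
      simp
    simp_rw [h0] at hs
    exact hs.unique hasSum_zero
  · intro n
    have := hg.1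
    have h2 : AEStronglyMeasurable (fun x => (g x : ℂ)) (gaussianReal 0 1) :=
      Complex.continuous_ofReal.comp_aestronglyMeasurable this
    exact h2.mul (by fun_prop)
  · intro n
    filter_upwards with x
    simp
  · filter_upwards with x
    exact (Real.summable_pow_div_factorial _).mul_left _
  · have e : ∀ x, ∑' n : ℕ, |g x| * ((|t| * |x|) ^ n / (n.factorial : ℝ))
        = |g x| * Real.exp (|t| * |x|) := by
      intro x
      rw [tsum_mul_left, Real.exp_eq_exp_ℝ, NormedSpace.exp_eq_tsum_div]
    simp_rw [e]
    exact (hg.abs).integrable_mul (memLp_exp_abs |t|)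
  · filter_upwards with x
    have he : HasSum (fun n : ℕ => ((t * x * Complex.I : ℂ)) ^ n / (n.factorial : ℂ))
        (Complex.exp (t * x * Complex.I)) := by
      rw [Complex.exp_eq_exp_ℂ]
      exact NormedSpace.expSeries_div_hasSum_exp (t * x * Complex.I : ℂ)
    exact he.mul_left (g x : ℂ)

lemma hermAe_zero {g : ℝ → ℝ} (hg : Integrable g (gaussianReal 0 1))
    (h : ∀ t : ℝ, ∫ x, (g x : ℂ) * Complex.exp (t * x * Complex.I) ∂(gaussianReal 0 1) = 0) :
    g =ᵐ[gaussianReal 0 1] 0 := by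
  have m1 : AEMeasurable (fun x => ENNReal.ofReal (g x)) (gaussianReal 0 1) :=
    hg.1.aemeasurable.ennreal_ofReal
  have m2 : AEMeasurable (fun x => ENNReal.ofReal (-g x)) (gaussianReal 0 1) :=
    hg.1.aemeasurable.neg.ennreal_ofReal
  have f1 : IsFiniteMeasure ((gaussianReal 0 1).withDensity (fun x => ENNReal.ofReal (g x))) :=
    isFiniteMeasure_withDensity_ofReal hg.2
  have f2 : IsFiniteMeasure ((gaussianReal 0 1).withDensity (fun x => ENNReal.ofReal (-g x))) :=
    isFiniteMeasure_withDensity_ofReal hg.neg.2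
  have heq : (gaussianReal 0 1).withDensity (fun x => ENNReal.ofReal (g x))
      = (gaussianReal 0 1).withDensity (fun x => ENNReal.ofReal (-g x)) := by
    apply Measure.ext_of_charFun
    ext t
    rw [charFun_apply_real, charFun_apply_real,
      integral_withDensity_eq_integral_toReal_smul₀ m1 (by simp),
      integral_withDensity_eq_integral_toReal_smul₀ m2 (by simp), ← sub_eq_zero, ← integral_sub]
    · rw [← h t]
      congr 1
      ext x
      rw [← sub_smul, Complex.real_smul]
      congr 2
      rcases le_total 0 (g x) with hx | hx
      · simp [ENNReal.toReal_ofReal, hx, ENNReal.ofReal_of_nonpos]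
      · rw [ENNReal.ofReal_of_nonpos hx, ENNReal.toReal_ofReal (by linarith)]; simp
    · have hi : Integrable (fun x => (ENNReal.ofReal (g x)).toReal) (gaussianReal 0 1) :=
        integrable_toReal_of_lintegral_ne_top m1
          (ne_of_lt (lt_of_le_of_lt (lintegral_ofReal_le_lintegral_enorm _) hg.2))
      simp_rw [Complex.real_smul]
      refine (hi.ofReal (𝕜 := ℂ)).mul_bdd (c := 1) (by fun_prop) (ae_of_all _ fun x => ?_)
      rw [← Complex.ofReal_mul, Complex.norm_exp_ofReal_mul_I]
    · have hi : Integrable (fun x => (ENNReal.ofReal (-g x)).toReal) (gaussianReal 0 1) :=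
        integrable_toReal_of_lintegral_ne_top m2
          (ne_of_lt (lt_of_le_of_lt (lintegral_ofReal_le_lintegral_enorm _) hg.neg.2))
      simp_rw [Complex.real_smul]
      refine (hi.ofReal (𝕜 := ℂ)).mul_bdd (c := 1) (by fun_prop) (ae_of_all _ fun x => ?_)
      rw [← Complex.ofReal_mul, Complex.norm_exp_ofReal_mul_I]
  rw [withDensity_eq_iff_of_sigmaFinite m1 m2] at heq
  filter_upwards [heq] with x hx
  rcases le_total 0 (g x) with h0 | h0
  · rw [ENNReal.ofReal_of_nonpos (by linarith : -g x ≤ 0), ENNReal.ofReal_eq_zero] at hx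
    exact le_antisymm hx h0
  · rw [ENNReal.ofReal_of_nonpos h0, eq_comm, ENNReal.ofReal_eq_zero] at hx
    exact le_antisymm h0 (neg_nonpos.1 hx)

lemma complete {g : ℝ → ℝ} (hg : MemLp g 2 (gaussianReal 0 1))
    (h : ∀ n, ∫ x, g x * (hR n).eval x ∂(gaussianReal 0 1) = 0) :
    g =ᵐ[gaussianReal 0 1] 0 :=
  hermAe_zero (hg.integrable (by norm_num)) (hermFourier_zero hg (moments_zero hg h))

/-- Normalized Hermite functions in `L²`. -/
noncomputable def eH (n : ℕ) : Lp ℝ 2 (gaussianReal 0 1) :=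
  (Real.sqrt n.factorial)⁻¹ • (memLp_poly (hR n)).toLp _

lemma inner_toLp_real {α : Type*} [MeasurableSpace α] {μ : Measure α} {u v : α → ℝ}
    (hu : MemLp u 2 μ) (hv : MemLp v 2 μ) :
    inner ℝ (hu.toLp u) (hv.toLp v) = ∫ x, u x * v x ∂μ := by
  rw [L2.inner_def]
  apply integral_congr_ae
  filter_upwards [hu.coeFn_toLp, hv.coeFn_toLp] with x h1 h2
  simp [h1, h2, mul_comm]

lemma sqrt_fact (n : ℕ) : (Real.sqrt n.factorial)⁻¹ * ((Real.sqrt n.factorial)⁻¹ * (n.factorial : ℝ)) = 1 := by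
  have h : (0:ℝ) < n.factorial := by positivity
  have := Real.mul_self_sqrt h.le
  have h3 := Real.sqrt_pos.2 h
  field_simp
  rw [sq, this]

lemma eH_orthonormal : Orthonormal ℝ eH := by
  rw [orthonormal_iff_ite]
  intro i j
  rw [eH, eH, real_inner_smul_left, real_inner_smul_right, inner_toLp_real]
  simp_rw [← Polynomial.eval_mul]
  rw [herm_orth]
  by_cases h : i = j
  · subst h
    simp only [if_true]
    exact sqrt_fact i
  · simp [h]

lemma eH_total : (Submodule.span ℝ (Set.range eH))ᗮ = ⊥ := by
  rw [Submodule.eq_bot_iff]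
  intro g hg
  have h : ∀ n, inner ℝ (eH n) g = 0 := fun n =>
    (Submodule.mem_orthogonal _ _).1 hg _ (Submodule.subset_span ⟨n, rfl⟩)
  have hgL := Lp.memLp g
  rw [Lp.eq_zero_iff_ae_eq_zero]
  apply complete hgL
  intro n
  have h1 := h n
  rw [eH, real_inner_smul_left] at h1
  nth_rw 1 [← Lp.toLp_coeFn g hgL] at h1
  rw [inner_toLp_real] at h1
  have h3 : Real.sqrt n.factorial ≠ 0 := (Real.sqrt_pos.2 (by positivity)).ne'
  rcases mul_eq_zero.1 h1 with h2 | h2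
  · exact absurd (inv_eq_zero.1 h2) h3
  · simpa [mul_comm] using h2

lemma mp_rot (ρ σ : ℝ) (h : ρ^2 + σ^2 = 1) :
    MeasurePreserving (fun z : ℝ × ℝ => ρ * z.1 + σ * z.2)
      ((gaussianReal 0 1).prod (gaussianReal 0 1)) (gaussianReal 0 1) := by
  refine ⟨by fun_prop, ?_⟩
  have h1 := gaussianReal_map_const_mul (μ := 0) (v := 1) ρ
  have h2 := gaussianReal_map_const_mul (μ := 0) (v := 1) σ
  have h3 : ((gaussianReal 0 1).map (ρ * ·)).conv ((gaussianReal 0 1).map (σ * ·))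
    = gaussianReal 0 1 := by
    rw [h1, h2, gaussianReal_conv_gaussianReal]
    congr 1
    · simp
    · ext; simpa using h
  rw [Measure.conv, Measure.map_prod_map _ _ (by fun_prop) (by fun_prop),
    Measure.map_map (by fun_prop) (by fun_prop)] at h3
  exact h3

lemma mehler_prod (ρ σ : ℝ) (h : ρ^2 + σ^2 = 1) (l m : ℕ) :
    ∫ z : ℝ × ℝ, (hR l).eval z.1 * (hR m).eval (ρ * z.1 + σ * z.2)
      ∂((gaussianReal 0 1).prod (gaussianReal 0 1))
      = if l = m then ρ ^ m * (m.factorial : ℝ) else 0 := by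
  rw [integral_prod]
  · simp_rw [integral_const_mul, mehler ρ σ h]
    have e : ∀ x, (hR l).eval x * (ρ ^ m * (hR m).eval x) = ρ ^ m * (hR l * hR m).eval x := by
      intro x; simp; ring
    simp_rw [e, integral_const_mul, herm_orth]
    by_cases h : l = m
    · subst h; simp
    · simp [h]
  · exact ((memLp_poly (hR l)).comp_measurePreserving measurePreserving_fst).integrable_mul
      ((memLp_poly (hR m)).comp_measurePreserving (mp_rot ρ σ h))

lemma mehler_f (ρ σ : ℝ) (h : ρ^2 + σ^2 = 1) {f : ℝ → ℝ} (hf : MemLp f 2 (gaussianReal 0 1))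
    (a : ℕ → ℝ)
    (ha : ∀ l, a l = (∫ x, f x * (hR l).eval x ∂(gaussianReal 0 1)) / (Nat.factorial l)) :
    HasSum (fun l => ρ ^ l * ((Nat.factorial l : ℝ) * (a l)^2))
      (∫ z : ℝ × ℝ, f z.1 * f (ρ * z.1 + σ * z.2)
        ∂((gaussianReal 0 1).prod (gaussianReal 0 1))) := by
  let b := HilbertBasis.mkOfOrthogonalEqBot eH_orthonormal eH_total
  let U := (Lp.compMeasurePreservingₗᵢ ℝ (E := ℝ) (p := 2) Prod.fst
    (measurePreserving_fst (μ := gaussianReal 0 1) (ν := gaussianReal 0 1))).toContinuousLinearMap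
  let V := (Lp.compMeasurePreservingₗᵢ ℝ (E := ℝ) (p := 2) _ (mp_rot ρ σ h)).toContinuousLinearMap
  let F := hf.toLp f
  have hb : ∀ i, b i = eH i := by
    intro i; simp [b]
  have hF : HasSum (fun i => b.repr F i • eH i) F := by
    have := b.hasSum_repr F
    simpa only [hb] using this
  have hUV : ∀ {u v : ℝ → ℝ} (hu : MemLp u 2 (gaussianReal 0 1)) (hv : MemLp v 2 (gaussianReal 0 1)),
      inner ℝ (U (hu.toLp u)) (V (hv.toLp v)) = ∫ z : ℝ × ℝ, u z.1 * v (ρ * z.1 + σ * z.2)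
        ∂((gaussianReal 0 1).prod (gaussianReal 0 1)) := by
    intro u v hu hv
    exact inner_toLp_real (hu.comp_measurePreserving measurePreserving_fst)
      (hv.comp_measurePreserving (mp_rot ρ σ h))
  have hc : ∀ i, b.repr F i = (Real.sqrt i.factorial)⁻¹ * (i.factorial * a i) := by
    intro i
    have h0 : (i.factorial : ℝ) ≠ 0 := by positivity
    rw [b.repr_apply_apply, hb, eH, real_inner_smul_left, inner_toLp_real, ha,
      mul_div_cancel₀ _ h0]
    simp_rw [mul_comm]
  have hee : ∀ i j, inner ℝ (U (eH i)) (V (eH j)) = if i = j then ρ ^ j else 0 := by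
    intro i j
    rw [eH, eH, map_smul, map_smul, real_inner_smul_left, real_inner_smul_right, hUV,
      mehler_prod ρ σ h]
    by_cases hij : i = j
    · subst hij
      simp only [if_true]
      linear_combination ρ ^ i * sqrt_fact i
    · simp [hij]
  have hFe : ∀ j, inner ℝ (V (eH j)) (U F) = b.repr F j * ρ ^ j := by
    intro j
    have h1 := (hF.mapL U).mapL (innerSL ℝ (V (eH j)))
    have h2 : HasSum (fun i => if i = j then b.repr F j * ρ ^ j else 0) (b.repr F j * ρ ^ j) :=
      hasSum_ite_eq j _
    refine h1.unique ?_
    convert! h2 using 1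
    ext i
    simp only [map_smul, innerSL_apply_apply, smul_eq_mul]
    rw [real_inner_comm, hee]
    by_cases hij : i = j
    · subst hij; simp
    · simp [hij]
  have hfin := (hF.mapL V).mapL (innerSL ℝ (U F))
  simp only [map_smul, innerSL_apply_apply, smul_eq_mul] at hfin
  rw [hUV hf hf] at hfin
  convert! hfin using 1
  ext l
  rw [real_inner_comm, hFe, hc]
  linear_combination - ρ ^ l * l.factorial * (a l)^2 * sqrt_fact l

/-- If `f` has Hermite rank `q` and `(X,Y)` is jointly standard Gaussian with
correlation `ρ`, then `|E[f(X)f(Y)]| ≤ |ρ|^q Σ_{l≥q} l! a_l²`. -/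
theorem stmt_2 {Ω : Type*} [MeasureSpace Ω] [IsProbabilityMeasure (ℙ : Measure Ω)]
    (f : ℝ → ℝ) (hfmeas : Measurable f)
    (hfL2 : Integrable (fun x => (f x)^2) (gaussianReal 0 1))
    (hf0 : ∫ x, f x ∂(gaussianReal 0 1) = 0)
    (a : ℕ → ℝ)
    (ha : ∀ l, a l = (∫ x, f x * He l x ∂(gaussianReal 0 1)) / (Nat.factorial l))
    (hsum : Summable fun l => (Nat.factorial l : ℝ) * (a l)^2)
    (q : ℕ) (hrank : ∀ l < q, a l = 0) (haq : a q ≠ 0)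
    (X Y : Ω → ℝ) (ρ : ℝ) (hρ : ρ ∈ Set.Icc (-1 : ℝ) 1)
    (hXY : Measure.map (fun ω => (X ω, Y ω)) ℙ
      = Measure.map (fun z : ℝ × ℝ => (z.1, ρ * z.1 + Real.sqrt (1 - ρ^2) * z.2))
          ((gaussianReal 0 1).prod (gaussianReal 0 1)))
    (hcor : ∫ ω, X ω * Y ω = ρ)
    (hint : Integrable (fun ω => f (X ω) * f (Y ω)) ℙ) :
    |∫ ω, f (X ω) * f (Y ω)|
      ≤ |ρ| ^ q * ∑' l, (Nat.factorial l : ℝ) * (a l)^2 := by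
  have hσ : ρ^2 + (Real.sqrt (1 - ρ^2))^2 = 1 := by
    rw [Real.sq_sqrt] <;> nlinarith [hρ.1, hρ.2]
  have hf : MemLp f 2 (gaussianReal 0 1) :=
    (memLp_two_iff_integrable_sq hfmeas.aestronglyMeasurable).2 hfL2
  have hs := mehler_f ρ _ hσ hf a (by simpa only [He_eq] using ha)
  have hae : AEMeasurable (fun ω => (X ω, Y ω)) (ℙ : Measure Ω) := by
    apply AEMeasurable.of_map_ne_zero
    rw [hXY]
    have : IsProbabilityMeasure (Measure.map
      (fun z : ℝ × ℝ => (z.1, ρ * z.1 + Real.sqrt (1 - ρ^2) * z.2))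
          ((gaussianReal 0 1).prod (gaussianReal 0 1))) :=
      Measure.isProbabilityMeasure_map (by fun_prop)
    exact IsProbabilityMeasure.ne_zero _
  have hm : Measurable (fun p : ℝ × ℝ => f p.1 * f p.2) := by fun_prop
  have hE : ∫ ω, f (X ω) * f (Y ω) = ∫ z : ℝ × ℝ, f z.1 * f (ρ * z.1 + Real.sqrt (1 - ρ^2) * z.2)
        ∂((gaussianReal 0 1).prod (gaussianReal 0 1)) := by
    have h1 := integral_map hae (f := fun p : ℝ × ℝ => f p.1 * f p.2) hm.aestronglyMeasurable
    rw [hXY, integral_map (by fun_prop) hm.aestronglyMeasurable] at h1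
    exact h1.symm
  rw [hE, ← hs.tsum_eq, ← tsum_mul_left]
  have hbd : ∀ l, ‖ρ ^ l * ((Nat.factorial l : ℝ) * (a l)^2)‖
      ≤ |ρ| ^ q * ((Nat.factorial l : ℝ) * (a l)^2) := by
    intro l
    have h0 : 0 ≤ (Nat.factorial l : ℝ) * (a l)^2 := by positivity
    rw [norm_mul, Real.norm_of_nonneg h0, Real.norm_eq_abs, abs_pow]
    by_cases hl : l < q
    · simp [hrank l hl]
    · exact mul_le_mul_of_nonneg_right
        (pow_le_pow_of_le_one (abs_nonneg _) (abs_le.2 hρ) (not_lt.1 hl)) h0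
  exact tsum_of_norm_bounded (hsum.mul_left _).hasSum hbd
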